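/- arXiv:1611.02807 — 4 statements merged into one kernel-verified Lean document; each statement's English description precedes it below -/
import Mathlib

section
/- Let $H$ be a real Hilbert space, let $e \in H$, and let $\delta$ be a continuous linear functional on $H$. Define the continuous linear functional $R$ on $H$ by $R(v) = \langle e, v\rangle + \delta(v)$ for all $v \in H$. Then $\|e\|^2 + \|\delta\|_*^2 \leq 5\,\|R\|_*^2 - 6\,\delta(e)$. -/
open scoped RealInnerProductSpace

/-- Abstract error–residual relation (Lemma 4.1): for a real Hilbert space `H`,
`e ∈ H`, a continuous linear functional `δ`, and the residual
`R v = ⟪e, v⟫ + δ v`, one has `‖e‖² + ‖δ‖² ≤ 5‖R‖² - 6 δ(e)`. -/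
theorem error_residual_relation
    {H : Type*} [NormedAddCommGroup H] [InnerProductSpace ℝ H] [CompleteSpace H]
    (e : H) (δ : H →L[ℝ] ℝ) (R : H →L[ℝ] ℝ)
    (hR : ∀ v : H, R v = ⟪e, v⟫ + δ v) :
    ‖e‖ ^ 2 + ‖δ‖ ^ 2 ≤ 5 * ‖R‖ ^ 2 - 6 * δ e := by
  obtain ⟨d, rfl⟩ := (InnerProductSpace.toDual ℝ H).surjective δ
  obtain rfl : R = InnerProductSpace.toDual ℝ H (e + d) := by
    ext v
    simp [hR]
  simp only [LinearIsometryEquiv.norm_map, InnerProductSpace.toDual_apply_apply]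
  have h_nonneg := sq_nonneg ‖e + d‖
  rw [norm_add_sq_real] at h_nonneg ⊢
  rw [real_inner_comm e d]
  linarith [sq_nonneg ‖e‖, sq_nonneg ‖d‖]
end

section
/- Let $a_1, a_2, a_3 \in \mathbb{R}^2$ be affinely independent points, let $T$ be their convex hull, and let $p : \mathbb{R}^2 \to \mathbb{R}$ be a polynomial function of total degree at most $2$. If $p$ is nonnegative at the three edge midpoints $\tfrac{a_1+a_2}{2}$, $\tfrac{a_2+a_3}{2}$, $\tfrac{a_1+a_3}{2}$, then $\int_T p \, dx \geq 0$. -/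
open MeasureTheory MvPolynomial

/-- The closed reference triangle with vertices `(0, 0)`, `(1, 0)`, `(0, 1)`. -/
def referenceTriangle : Set (Fin 2 → ℝ) := {x | 0 ≤ x 0 ∧ 0 ≤ x 1 ∧ x 0 + x 1 ≤ 1}

theorem isCompact_referenceTriangle : IsCompact referenceTriangle := by
  refine (isCompact_Icc (a := (0 : Fin 2 → ℝ)) (b := 1)).of_isClosed_subset ?_ ?_
  · exact (isClosed_le continuous_const (continuous_apply 0)).inter
      ((isClosed_le continuous_const (continuous_apply 1)).inter
        (isClosed_le ((continuous_apply 0).add (continuous_apply 1)) continuous_const))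
  · rintro x ⟨h₀, h₁, h⟩
    simp only [Set.mem_Icc, Pi.le_def, Fin.forall_fin_two, Pi.zero_apply, Pi.one_apply]
    refine ⟨⟨h₀, h₁⟩, ?_, ?_⟩ <;> linarith

/-- The affine parametrization of the triangle with vertices `a`, `b`, `c`. -/
theorem image_referenceTriangle {V : Type*} [AddCommGroup V] [Module ℝ V] (a b c : V) :
    (fun x => a + Fintype.linearCombination ℝ ![b - a, c - a] x) '' referenceTriangle =
      convexHull ℝ {a, b, c} := by
  simp only [Fintype.linearCombination_apply, Fin.sum_univ_two, Matrix.cons_val_zero,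
    Matrix.cons_val_one]
  refine Set.Subset.antisymm ?_ ?_
  · rintro _ ⟨x, ⟨h₀, h₁, h⟩, rfl⟩
    have hmem : ∀ i, ![a, b, c] i ∈ convexHull ℝ {a, b, c} := by
      intro i
      apply subset_convexHull
      fin_cases i <;> simp
    have := (convex_convexHull ℝ {a, b, c}).sum_mem (t := Finset.univ)
      (w := ![1 - x 0 - x 1, x 0, x 1]) (z := ![a, b, c])
      (by
        intro i _
        fin_cases i
        · change 0 ≤ 1 - x 0 - x 1
          linarith
        · exact h₀
        · exact h₁)
      (by simp only [Fin.sum_univ_three, Matrix.cons_val]; ring) (fun i _ => hmem i)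
    convert this using 1
    simp only [Fin.sum_univ_three, Matrix.cons_val]
    module
  · intro y hy
    rw [convexHull_insert (Set.insert_nonempty _ _), convexHull_pair] at hy
    simp only [mem_convexJoin, Set.mem_singleton_iff, exists_eq_left] at hy
    obtain ⟨_, ⟨β, γ, hβ, hγ, hβγ, rfl⟩, l, m, hl, hm, hlm, rfl⟩ := hy
    refine ⟨![m * β, m * γ], ⟨mul_nonneg hm hβ, mul_nonneg hm hγ, ?_⟩, ?_⟩
    · change m * β + m * γ ≤ 1
      rw [← mul_add, hβγ]
      linarith
    · obtain rfl : l = 1 - m := by linarith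
      obtain rfl : β = 1 - γ := by linarith
      simp only [Matrix.cons_val_zero, Matrix.cons_val_one]
      module

theorem AffineIndependent.linearIndependent_sub_pair {V : Type*} [AddCommGroup V] [Module ℝ V]
    {a b c : V} (h : AffineIndependent ℝ ![a, b, c]) :
    LinearIndependent ℝ ![b - a, c - a] := by
  rw [affineIndependent_iff_linearIndependent_vsub ℝ _ 0] at h
  have h' := h.comp (fun i : Fin 2 => ⟨i.succ, Fin.succ_ne_zero i⟩)
    fun i j hij => Fin.succ_injective _ (congrArg Subtype.val hij)
  have heq : ![b - a, c - a] = fun i : Fin 2 => ![a, b, c] i.succ -ᵥ ![a, b, c] 0 := by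
    ext i
    fin_cases i <;> rfl
  rw [heq]
  exact h'

theorem exists_eval_eq_of_totalDegree_le_two (p : MvPolynomial (Fin 2) ℝ)
    (hp : p.totalDegree ≤ 2) :
    ∃ A B C D E F : ℝ, ∀ x : Fin 2 → ℝ,
      eval x p = A + B * x 0 + C * x 1 + D * x 0 ^ 2 + E * (x 0 * x 1) + F * x 1 ^ 2 := by
  suffices h : ∃ A B C D E F : ℝ, (fun x : Fin 2 → ℝ => eval x p) = fun x =>
      A + B * x 0 + C * x 1 + D * x 0 ^ 2 + E * (x 0 * x 1) + F * x 1 ^ 2 by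
    simpa only [funext_iff] using h
  have hsum : (fun x : Fin 2 → ℝ => eval x p) =
      ∑ d ∈ p.support, fun x => p.coeff d * ∏ i, x i ^ d i := by
    ext x
    rw [eval_eq', Finset.sum_apply]
  rw [hsum]
  refine Finset.sum_induction _ (fun f : (Fin 2 → ℝ) → ℝ => ∃ A B C D E F : ℝ, f = fun x =>
      A + B * x 0 + C * x 1 + D * x 0 ^ 2 + E * (x 0 * x 1) + F * x 1 ^ 2) ?_ ?_ ?_
  · rintro _ _ ⟨A, B, C, D, E, F, rfl⟩ ⟨A', B', C', D', E', F', rfl⟩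
    refine ⟨A + A', B + B', C + C', D + D', E + E', F + F', ?_⟩
    ext x
    simp only [Pi.add_apply]
    ring
  · exact ⟨0, 0, 0, 0, 0, 0, by ext; simp⟩
  · intro d hd
    have hd2 : d 0 + d 1 ≤ 2 := by
      have := (le_totalDegree hd).trans hp
      rwa [Finsupp.sum_fintype _ _ (fun _ => rfl), Fin.sum_univ_two] at this
    simp only [Fin.prod_univ_two]
    generalize p.coeff d = c
    obtain h | h | h | h | h | h : (d 0 = 0 ∧ d 1 = 0) ∨ (d 0 = 1 ∧ d 1 = 0) ∨
        (d 0 = 0 ∧ d 1 = 1) ∨ (d 0 = 2 ∧ d 1 = 0) ∨ (d 0 = 1 ∧ d 1 = 1) ∨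
        (d 0 = 0 ∧ d 1 = 2) := by omega
    all_goals rw [h.1, h.2]
    · exact ⟨c, 0, 0, 0, 0, 0, by ext; ring⟩
    · exact ⟨0, c, 0, 0, 0, 0, by ext; ring⟩
    · exact ⟨0, 0, c, 0, 0, 0, by ext; ring⟩
    · exact ⟨0, 0, 0, c, 0, 0, by ext; ring⟩
    · exact ⟨0, 0, 0, 0, c, 0, by ext; ring⟩
    · exact ⟨0, 0, 0, 0, 0, c, by ext; ring⟩

/-- Integration over the reference triangle as an iterated integral. -/
theorem setIntegral_referenceTriangle {f : (Fin 2 → ℝ) → ℝ} (hf : Continuous f) :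
    ∫ x in referenceTriangle, f x = ∫ s in (0 : ℝ)..1, ∫ t in (0 : ℝ)..(1 - s), f ![s, t] := by
  have hmeas := isCompact_referenceTriangle.measurableSet
  have hint : Integrable (referenceTriangle.indicator f) :=
    (integrable_indicator_iff hmeas).2
      (hf.continuousOn.integrableOn_compact isCompact_referenceTriangle)
  have hmp := (volume_preserving_finTwoArrow ℝ).symm
  rw [← integral_indicator hmeas, ← hmp.integral_comp', Measure.volume_eq_prod,
    integral_prod (fun z => referenceTriangle.indicator f (MeasurableEquiv.finTwoArrow.symm z))
      (hmp.integrable_comp_of_integrable hint),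
    intervalIntegral.integral_of_le zero_le_one, ← integral_Icc_eq_integral_Ioc,
    ← integral_indicator measurableSet_Icc]
  congr 1
  ext s
  by_cases hs : s ∈ Set.Icc (0 : ℝ) 1
  · rw [Set.indicator_of_mem hs, intervalIntegral.integral_of_le (by linarith [hs.2]),
      ← integral_Icc_eq_integral_Ioc, ← integral_indicator measurableSet_Icc]
    congr 1
    ext t
    have hiff : ![s, t] ∈ referenceTriangle ↔ t ∈ Set.Icc 0 (1 - s) :=
      ⟨fun h => ⟨h.2.1, le_sub_iff_add_le'.2 h.2.2⟩,
        fun h => ⟨hs.1, h.1, le_sub_iff_add_le'.1 h.2⟩⟩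
    change referenceTriangle.indicator f ![s, t] = _
    simp only [Set.indicator, hiff]
  · rw [Set.indicator_of_notMem hs]
    refine integral_eq_zero_of_ae (.of_forall fun t => Set.indicator_of_notMem (fun h => hs ?_) f)
    obtain ⟨h₀, h₁, h₂⟩ : 0 ≤ s ∧ 0 ≤ t ∧ s + t ≤ 1 := h
    exact ⟨h₀, by linarith⟩

theorem setIntegral_referenceTriangle_quadratic (A B C D E F : ℝ) :
    ∫ x in referenceTriangle,
        (A + B * x 0 + C * x 1 + D * x 0 ^ 2 + E * (x 0 * x 1) + F * x 1 ^ 2) =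
      A / 2 + B / 6 + C / 6 + D / 12 + E / 24 + F / 12 := by
  rw [setIntegral_referenceTriangle (by fun_prop)]
  have h (s : ℝ) : ∫ t in (0 : ℝ)..(1 - s), (A + B * s + C * t + D * s ^ 2 + E * (s * t) +
      F * t ^ 2) = (A + B * s + D * s ^ 2) * (1 - s) + (C + E * s) * ((1 - s) ^ 2 / 2) +
        F * ((1 - s) ^ 3 / 3) := by
    rw [intervalIntegral.integral_eq_sub_of_hasDerivAt (f := fun t =>
      (A + B * s + D * s ^ 2) * t + (C + E * s) * (t ^ 2 / 2) + F * (t ^ 3 / 3))]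
    · ring
    · intro t _
      refine ((((hasDerivAt_id t).const_mul _).add (((hasDerivAt_pow 2 t).div_const 2).const_mul
        _)).add (((hasDerivAt_pow 3 t).div_const 3).const_mul _)).congr_deriv ?_
      norm_num
      ring
    · exact Continuous.intervalIntegrable (by fun_prop) _ _
  simp only [Matrix.cons_val_zero, Matrix.cons_val_one, h]
  rw [intervalIntegral.integral_eq_sub_of_hasDerivAt (f := fun s =>
    (A + C / 2 + F / 3) * s + (B - A - C + E / 2 - F) * (s ^ 2 / 2) +
      (D - B + C / 2 - E + F) * (s ^ 3 / 3) + (E / 2 - D - F / 3) * (s ^ 4 / 4))]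
  · ring
  · intro s _
    refine (((((hasDerivAt_id s).const_mul _).add (((hasDerivAt_pow 2 s).div_const 2).const_mul
      _)).add (((hasDerivAt_pow 3 s).div_const 3).const_mul _)).add
      (((hasDerivAt_pow 4 s).div_const 4).const_mul _)).congr_deriv ?_
    norm_num
    ring
  · exact Continuous.intervalIntegrable (by fun_prop) _ _

/-- The edge midpoint quadrature rule on a triangle is exact for quadratic polynomials. -/
theorem setIntegral_convexHull_eq_midpoint_rule {a b c : Fin 2 → ℝ}
    (hind : AffineIndependent ℝ ![a, b, c]) (p : MvPolynomial (Fin 2) ℝ)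
    (hp : p.totalDegree ≤ 2) :
    ∫ x in convexHull ℝ {a, b, c}, eval x p =
      |LinearMap.det (Fintype.linearCombination ℝ ![b - a, c - a])| / 6 *
        (eval (midpoint ℝ a b) p + eval (midpoint ℝ b c) p + eval (midpoint ℝ a c) p) := by
  set L := Fintype.linearCombination ℝ ![b - a, c - a] with hL
  have hderiv (x : Fin 2 → ℝ) : HasFDerivAt (fun x => a + L x) L.toContinuousLinearMap x :=
    L.toContinuousLinearMap.hasFDerivAt.const_add a
  have hinj : Function.Injective fun x => a + L x :=
    (add_right_injective a).comp
      hind.linearIndependent_sub_pair.fintypeLinearCombination_injective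
  obtain ⟨A, B, C, D, E, F, hq⟩ := exists_eval_eq_of_totalDegree_le_two p hp
  have hLapply (x : Fin 2 → ℝ) (i : Fin 2) :
      L x i = x 0 * (b i - a i) + x 1 * (c i - a i) := by
    simp [hL, Fintype.linearCombination_apply, Fin.sum_univ_two]
  have hpull (x : Fin 2 → ℝ) : eval (a + L x) p =
      (A + B * a 0 + C * a 1 + D * a 0 ^ 2 + E * (a 0 * a 1) + F * a 1 ^ 2) +
      (B * (b 0 - a 0) + C * (b 1 - a 1) + 2 * D * a 0 * (b 0 - a 0) +
        E * (a 0 * (b 1 - a 1) + a 1 * (b 0 - a 0)) + 2 * F * a 1 * (b 1 - a 1)) * x 0 +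
      (B * (c 0 - a 0) + C * (c 1 - a 1) + 2 * D * a 0 * (c 0 - a 0) +
        E * (a 0 * (c 1 - a 1) + a 1 * (c 0 - a 0)) + 2 * F * a 1 * (c 1 - a 1)) * x 1 +
      (D * (b 0 - a 0) ^ 2 + E * ((b 0 - a 0) * (b 1 - a 1)) + F * (b 1 - a 1) ^ 2) * x 0 ^ 2 +
      (2 * D * (b 0 - a 0) * (c 0 - a 0) +
        E * ((b 0 - a 0) * (c 1 - a 1) + (b 1 - a 1) * (c 0 - a 0)) +
        2 * F * (b 1 - a 1) * (c 1 - a 1)) * (x 0 * x 1) +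
      (D * (c 0 - a 0) ^ 2 + E * ((c 0 - a 0) * (c 1 - a 1)) + F * (c 1 - a 1) ^ 2) * x 1 ^ 2 := by
    simp only [hq, Pi.add_apply, hLapply]
    ring
  have hmid (y z : Fin 2 → ℝ) (i : Fin 2) : midpoint ℝ y z i = (y i + z i) / 2 := by
    simp [midpoint_eq_smul_add]
    ring
  rw [← image_referenceTriangle, integral_image_eq_integral_abs_det_fderiv_smul volume
    isCompact_referenceTriangle.measurableSet (fun x _ => (hderiv x).hasFDerivWithinAt)
    hinj.injOn]
  simp only [hpull, integral_smul]
  rw [setIntegral_referenceTriangle_quadratic, LinearMap.det_toContinuousLinearMap, smul_eq_mul]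
  simp only [hq, hmid]
  ring

/-- If a quadratic polynomial is nonnegative at the three edge midpoints of a
triangle `T = conv{a₁, a₂, a₃}`, then its integral over `T` is nonnegative. -/
theorem triangle_midpoint_nonneg_integral_nonneg
    (a₁ a₂ a₃ : Fin 2 → ℝ) (hind : AffineIndependent ℝ ![a₁, a₂, a₃])
    (p : MvPolynomial (Fin 2) ℝ) (hp : p.totalDegree ≤ 2)
    (h₁₂ : 0 ≤ eval (midpoint ℝ a₁ a₂) p)
    (h₂₃ : 0 ≤ eval (midpoint ℝ a₂ a₃) p)
    (h₁₃ : 0 ≤ eval (midpoint ℝ a₁ a₃) p) :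
    0 ≤ ∫ x in convexHull ℝ {a₁, a₂, a₃}, eval x p := by
  rw [setIntegral_convexHull_eq_midpoint_rule hind p hp]
  positivity
end

section
/- Let $a_1, a_2, a_3, a_4 \in \mathbb{R}^3$ be affinely independent points and let $T$ be their convex hull (a tetrahedron). There exists a polynomial function $p : \mathbb{R}^3 \to \mathbb{R}$ of total degree at most $2$ such that $p$ is nonnegative at all six edge midpoints $\tfrac{a_i + a_j}{2}$ ($1 \le i < j \le 4$) of $T$, yet $\int_T p \, dx < 0$. -/
open MeasureTheory MvPolynomial

/-- The corner simplex `{y | 0 ≤ y, ∑ y ≤ r}`. -/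
def cornerSimplex (n : ℕ) (r : ℝ) : Set (Fin n → ℝ) := {y | (∀ i, 0 ≤ y i) ∧ ∑ i, y i ≤ r}

theorem isClosed_cornerSimplex (n : ℕ) (r : ℝ) : IsClosed (cornerSimplex n r) := by
  have h : cornerSimplex n r = (⋂ i, {y | 0 ≤ y i}) ∩ {y | ∑ i, y i ≤ r} := by
    ext y; simp [cornerSimplex]
  rw [h]
  exact (isClosed_iInter fun i => isClosed_le continuous_const (continuous_apply i)).inter
    (isClosed_le (by fun_prop) continuous_const)

theorem cornerSimplex_subset_Icc (n : ℕ) (r : ℝ) :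
    cornerSimplex n r ⊆ Set.Icc 0 (fun _ => r) := fun _ hy =>
  ⟨hy.1, fun i => (Finset.single_le_sum (fun j _ => hy.1 j) (Finset.mem_univ i)).trans hy.2⟩

theorem isCompact_cornerSimplex (n : ℕ) (r : ℝ) : IsCompact (cornerSimplex n r) :=
  isCompact_Icc.of_isClosed_subset (isClosed_cornerSimplex n r) (cornerSimplex_subset_Icc n r)

theorem convex_cornerSimplex (n : ℕ) (r : ℝ) : Convex ℝ (cornerSimplex n r) := by
  intro x hx y hy a b ha hb hab
  refine ⟨fun i => ?_, ?_⟩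
  · have := hx.1 i
    have := hy.1 i
    simp only [Pi.add_apply, Pi.smul_apply, smul_eq_mul]
    positivity
  · simp only [Pi.add_apply, Pi.smul_apply, smul_eq_mul, Finset.sum_add_distrib,
      ← Finset.mul_sum]
    calc _ ≤ a * r + b * r := by gcongr; exacts [hx.2, hy.2]
      _ = r := by rw [← add_mul, hab, one_mul]

theorem volume_real_cornerSimplex_one_pos (n : ℕ) : 0 < volume.real (cornerSimplex n 1) := by
  have hsub : Set.Icc (0 : Fin n → ℝ) (fun _ => ((n : ℝ) + 1)⁻¹) ⊆ cornerSimplex n 1 := by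
    refine fun y hy => ⟨hy.1, (Finset.sum_le_sum fun i _ => hy.2 i).trans ?_⟩
    rw [Finset.sum_const, Finset.card_univ, Fintype.card_fin, nsmul_eq_mul,
      ← div_eq_mul_inv, div_le_one (by positivity)]
    linarith
  refine lt_of_lt_of_le ?_ (measureReal_mono hsub (isCompact_cornerSimplex n 1).measure_ne_top)
  rw [measureReal_def, Real.volume_Icc_pi_toReal (fun i => by simp only [Pi.zero_apply]; positivity)]
  exact Finset.prod_pos fun i _ => by simp only [Pi.zero_apply, sub_zero]; positivity

open scoped Pointwise in
theorem smul_cornerSimplex_one (n : ℕ) {r : ℝ} (hr : 0 < r) :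
    r • cornerSimplex n 1 = cornerSimplex n r := by
  ext y
  rw [Set.mem_smul_set_iff_inv_smul_mem₀ hr.ne']
  simp only [cornerSimplex, Set.mem_ofPred_eq, Pi.smul_apply, smul_eq_mul, ← Finset.mul_sum]
  refine and_congr (forall_congr' fun i => ?_) ?_
  · exact mul_nonneg_iff_of_pos_left (inv_pos.2 hr)
  · rw [inv_mul_le_iff₀ hr, mul_one]

theorem volume_real_cornerSimplex (n : ℕ) {r : ℝ} (hr : 0 < r) :
    volume.real (cornerSimplex n r) = r ^ n * volume.real (cornerSimplex n 1) := by
  rw [← smul_cornerSimplex_one n hr, measureReal_def, Measure.addHaar_smul,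
    ENNReal.toReal_mul, ENNReal.toReal_ofReal (abs_nonneg _), Module.finrank_fin_fun,
    abs_of_pos (pow_pos hr n), measureReal_def]

theorem cons_mem_cornerSimplex_iff {n : ℕ} {r t : ℝ} {z : Fin n → ℝ} :
    (Fin.cons t z : Fin (n + 1) → ℝ) ∈ cornerSimplex (n + 1) r ↔
      0 ≤ t ∧ z ∈ cornerSimplex n (r - t) := by
  simp only [cornerSimplex, Set.mem_ofPred_eq, Fin.forall_fin_succ, Fin.cons_zero, Fin.cons_succ,
    Fin.sum_univ_succ, and_assoc, le_sub_iff_add_le']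

theorem setIntegral_cornerSimplex_apply_zero (n : ℕ) {g : ℝ → ℝ} (hg : Continuous g) :
    ∫ y in cornerSimplex (n + 1) 1, g (y 0) =
      (∫ t in (0 : ℝ)..1, g t * (1 - t) ^ n) * volume.real (cornerSimplex n 1) := by
  have hS := (isClosed_cornerSimplex (n + 1) 1).measurableSet
  have h_int : Integrable ((cornerSimplex (n + 1) 1).indicator fun y => g (y 0)) := by
    rw [integrable_indicator_iff hS]
    exact (hg.comp (continuous_apply 0)).continuousOn.integrableOn_compact
      (isCompact_cornerSimplex (n + 1) 1)
  have hmp := (volume_preserving_piFinSuccAbove (fun _ : Fin (n + 1) => ℝ) 0).symm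
  rw [← integral_indicator hS, ← hmp.integral_comp (MeasurableEquiv.measurableEmbedding _)]
  have h_int' := (hmp.integrable_comp_emb (MeasurableEquiv.measurableEmbedding _)).2 h_int
  rw [Measure.volume_eq_prod] at h_int' ⊢
  rw [integral_prod (fun p : ℝ × (Fin n → ℝ) => (cornerSimplex (n + 1) 1).indicator
      (fun y => g (y 0)) ((MeasurableEquiv.piFinSuccAbove (fun _ : Fin (n + 1) => ℝ) 0).symm p)) h_int',
    intervalIntegral.integral_of_le zero_le_one,
    ← integral_Icc_eq_integral_Ioc, integral_Icc_eq_integral_Ico,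
    ← integral_mul_const, ← integral_indicator measurableSet_Ico]
  have hne : ∀ᵐ t : ℝ, t ≠ 1 := by simp [ae_iff]
  refine integral_congr_ae (hne.mono fun t ht => ?_)
  have hslice : ∀ z : Fin n → ℝ, (cornerSimplex (n + 1) 1).indicator (fun y => g (y 0))
      ((MeasurableEquiv.piFinSuccAbove (fun _ : Fin (n + 1) => ℝ) 0).symm (t, z)) =
      {z | 0 ≤ t ∧ z ∈ cornerSimplex n (1 - t)}.indicator (fun _ => g t) z := by
    intro z
    have : (MeasurableEquiv.piFinSuccAbove (fun _ : Fin (n + 1) => ℝ) 0).symm (t, z) =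
        (Fin.cons t z : Fin (n + 1) → ℝ) := by
      simp [MeasurableEquiv.piFinSuccAbove, Fin.insertNthEquiv]
    classical
    rw [this]
    simp only [Set.indicator_apply, cons_mem_cornerSimplex_iff, Fin.cons_zero, Set.mem_ofPred_eq]
  simp only [hslice]
  by_cases h : t ∈ Set.Ico (0 : ℝ) 1
  · rw [Set.indicator_of_mem h]
    have h0 : {z | 0 ≤ t ∧ z ∈ cornerSimplex n (1 - t)} = cornerSimplex n (1 - t) := by
      ext; simp [h.1]
    rw [h0, integral_indicator (isClosed_cornerSimplex n _).measurableSet, setIntegral_const,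
      volume_real_cornerSimplex n (sub_pos.2 h.2), smul_eq_mul]
    ring
  · rw [Set.indicator_of_notMem h]
    have h0 : {z | 0 ≤ t ∧ z ∈ cornerSimplex n (1 - t)} = ∅ := by
      refine Set.eq_empty_of_forall_notMem fun z hz => h ⟨hz.1, lt_of_le_of_ne ?_ ht⟩
      exact sub_nonneg.1 ((Finset.sum_nonneg fun i _ => hz.2.1 i).trans hz.2.2)
    simp [h0]

theorem setIntegral_cornerSimplex_three_neg :
    ∫ y in cornerSimplex 3 1, y 0 * (2 * y 0 - 1) < 0 := by
  rw [setIntegral_cornerSimplex_apply_zero 2 (g := fun t => t * (2 * t - 1)) (by fun_prop)]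
  refine mul_neg_of_neg_of_pos ?_ (volume_real_cornerSimplex_one_pos 2)
  have h : ∀ t : ℝ, t * (2 * t - 1) * (1 - t) ^ 2 = 2 * t ^ 4 - 5 * t ^ 3 + 4 * t ^ 2 - t := by
    intro t; ring
  have hi : ∀ {f : ℝ → ℝ}, Continuous f → IntervalIntegrable f volume 0 1 :=
    fun hf => hf.intervalIntegrable 0 1
  simp only [h]
  rw [intervalIntegral.integral_sub (hi (by fun_prop)) (hi (by fun_prop)),
    intervalIntegral.integral_add (hi (by fun_prop)) (hi (by fun_prop)),
    intervalIntegral.integral_sub (hi (by fun_prop)) (hi (by fun_prop))]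
  simp only [intervalIntegral.integral_const_mul, integral_pow, integral_id]
  norm_num

theorem image_cornerSimplex_one {n : ℕ} {E : Type*} [AddCommGroup E] [Module ℝ E] (a : E)
    (v : Fin n → E) :
    (fun y : Fin n → ℝ => a + ∑ i, y i • v i) '' cornerSimplex n 1 =
      convexHull ℝ (insert a (Set.range fun i => a + v i)) := by
  apply Set.Subset.antisymm
  · rintro _ ⟨y, hy, rfl⟩
    have h : a + ∑ i, y i • v i = ∑ i : Fin (n + 1),
        (Fin.cons (1 - ∑ i, y i) y : Fin (n + 1) → ℝ) i •
          (Fin.cons a (fun i => a + v i) : Fin (n + 1) → E) i := by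
      simp only [Fin.sum_univ_succ, Fin.cons_zero, Fin.cons_succ, smul_add,
        Finset.sum_add_distrib, ← Finset.sum_smul, sub_smul, one_smul]
      abel
    simp only [h]
    refine (convex_convexHull ℝ _).sum_mem ?_ ?_ ?_
    · intro i _
      refine Fin.cases ?_ (fun j => ?_) i
      · simpa using hy.2
      · simpa using hy.1 j
    · simp [Fin.sum_univ_succ]
    · intro i _
      apply subset_convexHull
      refine Fin.cases ?_ (fun j => ?_) i
      · simp
      · simp
  · refine convexHull_min ?_ ?_
    · rintro _ (rfl | ⟨i, rfl⟩)
      · exact ⟨0, by simp [cornerSimplex], by simp⟩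
      · refine ⟨Pi.single i 1, ⟨fun j => ?_, by simp⟩, ?_⟩
        · exact (Pi.single_nonneg.2 zero_le_one : (0 : Fin n → ℝ) ≤ Pi.single i 1) j
        · simp [Pi.single_apply, ite_smul]
    · have := ((convex_cornerSimplex n 1).is_linear_image
        (f := fun y : Fin n → ℝ => ∑ i, y i • v i) (Fintype.linearCombination ℝ v).isLinear).translate a
      rwa [Set.image_image] at this

/-- An affine function in `n` real variables is a polynomial of degree at most one. -/
theorem exists_mvPolynomial_eval_eq_sub {n : ℕ} (φ : (Fin n → ℝ) →ₗ[ℝ] ℝ) (a : Fin n → ℝ) :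
    ∃ q : MvPolynomial (Fin n) ℝ, q.totalDegree ≤ 1 ∧ ∀ x, eval x q = φ (x - a) := by
  refine ⟨∑ i, C (φ (Pi.single i 1)) * X i - C (φ a), ?_, fun x => ?_⟩
  · refine (totalDegree_sub_C_le _ _).trans (totalDegree_finsetSum_le fun i _ => ?_)
    refine (totalDegree_mul _ _).trans ?_
    simp
  · have hx : φ x = ∑ i, φ (Pi.single i 1) * x i := by
      conv_lhs => rw [pi_eq_sum_univ' x, map_sum]
      exact Finset.sum_congr rfl fun i _ => by
        rw [map_smul, smul_eq_mul, mul_comm]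
    simp [hx]

/-- On a tetrahedron, there is a quadratic polynomial that is nonnegative at
all six edge midpoints yet has negative integral, so the two-dimensional
midpoint-constraint principle fails in three dimensions. -/
theorem tetrahedron_midpoint_principle_fails
    (a₁ a₂ a₃ a₄ : Fin 3 → ℝ) (hind : AffineIndependent ℝ ![a₁, a₂, a₃, a₄]) :
    ∃ p : MvPolynomial (Fin 3) ℝ, p.totalDegree ≤ 2 ∧
      0 ≤ eval (midpoint ℝ a₁ a₂) p ∧ 0 ≤ eval (midpoint ℝ a₁ a₃) p ∧
      0 ≤ eval (midpoint ℝ a₁ a₄) p ∧ 0 ≤ eval (midpoint ℝ a₂ a₃) p ∧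
      0 ≤ eval (midpoint ℝ a₂ a₄) p ∧ 0 ≤ eval (midpoint ℝ a₃ a₄) p ∧
      (∫ x in convexHull ℝ {a₁, a₂, a₃, a₄}, eval x p) < 0 := by
  have hli : LinearIndependent ℝ ![a₂ - a₁, a₃ - a₁, a₄ - a₁] := by
    have h := ((affineIndependent_iff_linearIndependent_vsub ℝ _ 0).1 hind).comp
      (fun i : Fin 3 => (⟨i.succ, Fin.succ_ne_zero i⟩ : {x : Fin 4 // x ≠ 0}))
      (fun i j h => by simpa using h)
    have he : ![a₂ - a₁, a₃ - a₁, a₄ - a₁] =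
        fun i : Fin 3 => ![a₁, a₂, a₃, a₄] i.succ - a₁ := by
      ext i : 1
      fin_cases i <;> rfl
    rw [he]
    exact h
  let b := basisOfLinearIndependentOfCardEqFinrank hli (by simp)
  have hb : ⇑b = ![a₂ - a₁, a₃ - a₁, a₄ - a₁] :=
    coe_basisOfLinearIndependentOfCardEqFinrank hli (by simp)
  obtain ⟨q, hqdeg, hq⟩ := exists_mvPolynomial_eval_eq_sub (b.coord 0) a₁
  have hp : ∀ x, eval x (q * (2 * q - 1)) = b.coord 0 (x - a₁) * (2 * b.coord 0 (x - a₁) - 1) :=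
    fun x => by simp [hq]
  have h2 : b.coord 0 (a₂ - a₁) = 1 := by
    simp [show a₂ - a₁ = b 0 by simp [hb]]
  have h3 : b.coord 0 (a₃ - a₁) = 0 := by
    simp [show a₃ - a₁ = b 1 by simp [hb]]
  have h4 : b.coord 0 (a₄ - a₁) = 0 := by
    simp [show a₄ - a₁ = b 2 by simp [hb]]
  have hmid : ∀ x y, b.coord 0 (midpoint ℝ x y - a₁) =
      (b.coord 0 (x - a₁) + b.coord 0 (y - a₁)) / 2 := by
    intro x y
    have : midpoint ℝ x y - a₁ = (2⁻¹ : ℝ) • ((x - a₁) + (y - a₁)) := by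
      ext i
      simp [midpoint_eq_smul_add]
      ring
    rw [this, map_smul, map_add, smul_eq_mul]
    ring
  have h1 : b.coord 0 (a₁ - a₁) = 0 := by simp
  refine ⟨q * (2 * q - 1), ?_, ?_, ?_, ?_, ?_, ?_, ?_, ?_⟩
  · refine (totalDegree_mul _ _).trans ?_
    have : (2 * q - 1 : MvPolynomial (Fin 3) ℝ).totalDegree ≤ 1 := by
      rw [← C_1, ← map_ofNat (C : ℝ →+* MvPolynomial (Fin 3) ℝ) 2]
      refine (totalDegree_sub_C_le _ _).trans ((totalDegree_mul _ _).trans ?_)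
      rw [totalDegree_C, zero_add]
      exact hqdeg
    omega
  iterate 6 rw [hp, hmid]; simp only [h1, h2, h3, h4]; norm_num
  let L : (Fin 3 → ℝ) ≃L[ℝ] (Fin 3 → ℝ) := b.equivFun.symm.toContinuousLinearEquiv
  have hL : ∀ y, L y = ∑ i, y i • b i := fun y => b.equivFun_symm_apply y
  have himage : convexHull ℝ {a₁, a₂, a₃, a₄} = (fun y => a₁ + L y) '' cornerSimplex 3 1 := by
    simp only [hL]
    rw [image_cornerSimplex_one]
    congr 2
    ext x
    simp [hb, Fin.exists_fin_succ, eq_comm]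
  have hdet : (L : (Fin 3 → ℝ) →L[ℝ] (Fin 3 → ℝ)).det ≠ 0 :=
    (LinearEquiv.isUnit_det' L.toLinearEquiv).ne_zero
  rw [himage, integral_image_eq_integral_abs_det_fderiv_smul volume
    (isClosed_cornerSimplex 3 1).measurableSet
    (fun y _ => (L.hasFDerivAt.const_add a₁).hasFDerivWithinAt)
    (fun x _ y _ h => L.injective (add_left_cancel h))]
  have hcoord : ∀ y, b.coord 0 (L y) = y 0 := fun y =>
    congr_fun (b.equivFun.apply_symm_apply y) 0
  simp only [hp, add_sub_cancel_left, hcoord, smul_eq_mul]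
  rw [integral_const_mul]
  exact mul_neg_of_pos_of_neg (abs_pos.2 hdet) setIntegral_cornerSimplex_three_neg
end

section
/- Let $a_1, a_2, a_3, a_4 \in \mathbb{R}^3$ be affinely independent points, let $T$ be their convex hull (a tetrahedron) with three-dimensional Lebesgue measure $|T|$, let $\lambda_1, \lambda_2, \lambda_3, \lambda_4$ be the associated barycentric coordinates, and let $b_T = 256\,\lambda_1 \lambda_2 \lambda_3 \lambda_4$. Then for any prescribed values $d_i \in \mathbb{R}$ ($1 \le i \le 4$) at the vertices, $d_{ij} \in \mathbb{R}$ ($1 \le i < j \le 4$) at the edge midpoints, and any prescribed mean value $m \in \mathbb{R}$, there exist a unique polynomial function $q : \mathbb{R}^3 \to \mathbb{R}$ of total degree at most $2$ and a unique $c \in \mathbb{R}$ such that $v = q + c\,b_T$ satisfies $v(a_i) = d_i$ for all $i$, $v\left(\tfrac{a_i + a_j}{2}\right) = d_{ij}$ for all $i < j$, and $\frac{1}{|T|}\int_T v \, dx = m$. -/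
open MeasureTheory MvPolynomial

/-- The quadratic Lagrange interpolant of the vertex values `d` and the edge midpoint values `dm`,
as a function of the four barycentric coordinates `l`. -/
def quadInterp {R : Type*} [CommRing R] (l d : Fin 4 → R) (dm : Fin 4 → Fin 4 → R) : R :=
  ∑ i, l i * (2 * l i - 1) * d i + ∑ i, ∑ j ∈ Finset.Ioi i, 4 * l i * l j * dm i j

lemma quadInterp_expand {R : Type*} [CommRing R] (l d : Fin 4 → R) (dm : Fin 4 → Fin 4 → R) :
    quadInterp l d dm = l 0 * (2 * l 0 - 1) * d 0 + l 1 * (2 * l 1 - 1) * d 1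
      + l 2 * (2 * l 2 - 1) * d 2 + l 3 * (2 * l 3 - 1) * d 3
      + 4 * (l 0 * l 1 * dm 0 1 + l 0 * l 2 * dm 0 2 + l 0 * l 3 * dm 0 3
        + l 1 * l 2 * dm 1 2 + l 1 * l 3 * dm 1 3 + l 2 * l 3 * dm 2 3) := by
  have h0 : Finset.Ioi (0 : Fin 4) = {1, 2, 3} := by decide
  have h1 : Finset.Ioi (1 : Fin 4) = {2, 3} := by decide
  have h2 : Finset.Ioi (2 : Fin 4) = {3} := by decide
  have h3 : Finset.Ioi (3 : Fin 4) = ∅ := by decide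
  simp only [quadInterp, Fin.sum_univ_four, h0, h1, h2, h3]
  simp
  ring

/-- Quadratic Lagrange interpolation reproduces polynomials of total degree at most two. -/
lemma eval_eq_quadInterp {q : MvPolynomial (Fin 3) ℝ} (hq : q.totalDegree ≤ 2)
    (a : Fin 4 → Fin 3 → ℝ) (l : Fin 4 → ℝ) (hl : ∑ i, l i = 1) :
    eval (∑ i, l i • a i) q =
      quadInterp l (fun i ↦ eval (a i) q) fun i j ↦ eval (midpoint ℝ (a i) (a j)) q := by
  simp only [eval_eq', quadInterp, Finset.mul_sum]
  simp only [Finset.sum_comm (s := Finset.Ioi _) (t := q.support),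
    Finset.sum_comm (s := Finset.univ (α := Fin 4)) (t := q.support), ← Finset.sum_add_distrib]
  refine Finset.sum_congr rfl fun s hs ↦ ?_
  trans quadInterp l (fun i ↦ q.coeff s * ∏ k, a i k ^ s k)
    fun i j ↦ q.coeff s * ∏ k, midpoint ℝ (a i) (a j) k ^ s k
  swap
  · simp only [quadInterp, Finset.sum_add_distrib]
  have hdeg : s 0 + s 1 + s 2 ≤ 2 := by
    have := (le_totalDegree hs).trans hq
    rwa [Finsupp.sum_fintype _ _ fun _ ↦ rfl, Fin.sum_univ_three] at this
  have hl3 : l 3 = 1 - l 0 - l 1 - l 2 := by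
    rw [Fin.sum_univ_four] at hl
    linear_combination hl
  rw [quadInterp_expand]
  simp only [Fin.prod_univ_three, Fin.sum_univ_four, midpoint_eq_smul_add, Pi.add_apply,
    Pi.smul_apply, smul_eq_mul, invOf_eq_inv, hl3]
  generalize s 0 = n₀, s 1 = n₁, s 2 = n₂ at hdeg
  have h0 : n₀ ≤ 2 := by omega
  have h1 : n₁ ≤ 2 := by omega
  have h2 : n₂ ≤ 2 := by omega
  interval_cases n₀ <;> interval_cases n₁ <;> interval_cases n₂ <;>
    first | omega | ring

/-- The polynomial of an affine function. -/
noncomputable def affinePoly (f : (Fin 3 → ℝ) →ᵃ[ℝ] ℝ) : MvPolynomial (Fin 3) ℝ :=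
  C (f 0) + ∑ k, C (f.linear (Pi.single k 1)) * X k

lemma eval_affinePoly (f : (Fin 3 → ℝ) →ᵃ[ℝ] ℝ) (x : Fin 3 → ℝ) :
    eval x (affinePoly f) = f x := by
  have h : f x = f.linear x + f 0 := by
    simpa using f.map_vadd 0 x
  have hsingle (k : Fin 3) : (fun j ↦ if k = j then (1 : ℝ) else 0) = Pi.single k 1 := by
    ext j
    simp [Pi.single_apply, eq_comm]
  rw [h, f.linear.pi_apply_eq_sum_univ x]
  simp [affinePoly, hsingle, add_comm, mul_comm]

lemma totalDegree_affinePoly_le (f : (Fin 3 → ℝ) →ᵃ[ℝ] ℝ) :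
    (affinePoly f).totalDegree ≤ 1 := by
  refine (totalDegree_add _ _).trans (max_le (by simp) (totalDegree_finsetSum_le fun k _ ↦ ?_))
  exact (totalDegree_mul _ _).trans (by simp)

lemma totalDegree_quadInterp_le {L : Fin 4 → MvPolynomial (Fin 3) ℝ}
    (hL : ∀ i, (L i).totalDegree ≤ 1) (d : Fin 4 → ℝ) (dm : Fin 4 → Fin 4 → ℝ) :
    (quadInterp L (fun i ↦ C (d i)) fun i j ↦ C (dm i j)).totalDegree ≤ 2 := by
  have hmul {p q : MvPolynomial (Fin 3) ℝ} (hp : p.totalDegree ≤ 1) (hq : q.totalDegree ≤ 1)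
      (c : ℝ) : (p * q * C c).totalDegree ≤ 2 := by
    have h1 := totalDegree_mul p q
    have h2 := totalDegree_mul (p * q) (C c)
    rw [totalDegree_C] at h2
    omega
  have htwo (i : Fin 4) : (2 * L i - 1).totalDegree ≤ 1 := by
    refine (totalDegree_sub _ _).trans (max_le ?_ (by simp))
    simpa [two_mul] using (totalDegree_add (L i) (L i)).trans (max_le (hL i) (hL i))
  have hfour (i : Fin 4) : (4 * L i).totalDegree ≤ 1 := by
    have h := totalDegree_mul (C 4) (L i)
    rw [totalDegree_C, map_ofNat] at h
    exact h.trans (by simpa using hL i)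
  refine (totalDegree_add _ _).trans (max_le (totalDegree_finsetSum_le fun i _ ↦ ?_)
    (totalDegree_finsetSum_le fun i _ ↦ totalDegree_finsetSum_le fun j _ ↦ ?_))
  · exact hmul (hL i) (htwo i) _
  · exact hmul (hfour i) (hL j) _

lemma eval_quadInterp (x : Fin 3 → ℝ) (L : Fin 4 → MvPolynomial (Fin 3) ℝ) (d : Fin 4 → ℝ)
    (dm : Fin 4 → Fin 4 → ℝ) :
    eval x (quadInterp L (fun i ↦ C (d i)) fun i j ↦ C (dm i j)) =
      quadInterp (fun i ↦ eval x (L i)) d dm := by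
  simp [quadInterp]

lemma setIntegral_bubble_pos (b : AffineBasis (Fin 4) ℝ (Fin 3 → ℝ)) :
    0 < ∫ x in convexHull ℝ (Set.range b),
      256 * (b.coord 0 x * b.coord 1 x * b.coord 2 x * b.coord 3 x) := by
  have hcomp : IsCompact (convexHull ℝ (Set.range b)) := (Set.finite_range b).isCompact_convexHull ℝ
  have hcont (i : Fin 4) : Continuous (b.coord i) := (b.coord i).continuous_of_finiteDimensional
  have hint : (interior (convexHull ℝ (Set.range b))).Nonempty :=
    interior_convexHull_nonempty_iff_affineSpan_eq_top.2 b.tot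
  rw [setIntegral_pos_iff_support_of_nonneg_ae]
  · refine (isOpen_interior.measure_pos volume hint).trans_le (measure_mono fun x hx ↦ ?_)
    refine ⟨?_, interior_subset hx⟩
    rw [b.interior_convexHull] at hx
    have := hx 0; have := hx 1; have := hx 2; have := hx 3
    simp only [Function.mem_support]
    positivity
  · filter_upwards [ae_restrict_mem hcomp.measurableSet] with x hx
    rw [b.convexHull_eq_nonneg_coord] at hx
    have := hx 0; have := hx 1; have := hx 2; have := hx 3
    simp only [Pi.zero_apply]
    positivity
  · exact (Continuous.continuousOn (by fun_prop)).integrableOn_compact hcomp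

/-- Unisolvence of the bubble-enriched quadratic element `P₂(T) ⊕ span{b_T}`
on a tetrahedron with respect to its eleven degrees of freedom: the ten nodal
values at the vertices and edge midpoints together with the integral mean can
be prescribed arbitrarily, by a unique function `v = q + c b_T` with `q`
quadratic and `c ∈ ℝ`. -/
theorem tetrahedron_enriched_P2_unisolvence
    (a : Fin 4 → (Fin 3 → ℝ)) (hind : AffineIndependent ℝ a)
    (lam : Fin 4 → ((Fin 3 → ℝ) →ᵃ[ℝ] ℝ))
    (hlam : ∀ i j, lam i (a j) = if i = j then 1 else 0)
    (bT : (Fin 3 → ℝ) → ℝ)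
    (hbT : ∀ x, bT x = 256 * (lam 0 x * lam 1 x * lam 2 x * lam 3 x))
    (d : Fin 4 → ℝ) (dm : Fin 4 → Fin 4 → ℝ) (m : ℝ) :
    ∃! qc : MvPolynomial (Fin 3) ℝ × ℝ,
      qc.1.totalDegree ≤ 2 ∧
      (∀ i, eval (a i) qc.1 + qc.2 * bT (a i) = d i) ∧
      (∀ i j : Fin 4, i < j →
        eval (midpoint ℝ (a i) (a j)) qc.1 + qc.2 * bT (midpoint ℝ (a i) (a j)) = dm i j) ∧
      (∫ x in convexHull ℝ (Set.range a), (eval x qc.1 + qc.2 * bT x)) /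
          (volume (convexHull ℝ (Set.range a))).toReal = m := by
  have hspan : affineSpan ℝ (Set.range a) = ⊤ := by
    rw [hind.affineSpan_eq_top_iff_card_eq_finrank_add_one]
    simp
  let b : AffineBasis (Fin 4) ℝ (Fin 3 → ℝ) := ⟨a, hind, hspan⟩
  obtain rfl : lam = b.coord := funext fun i ↦ AffineMap.ext_on hspan <| by
    rintro _ ⟨j, rfl⟩
    rw [hlam]
    exact (b.coord_apply i j).symm
  have hI : 0 < ∫ x in convexHull ℝ (Set.range a), bT x := by
    simp only [hbT]
    exact setIntegral_bubble_pos b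
  have hcomp : IsCompact (convexHull ℝ (Set.range a)) := (Set.finite_range a).isCompact_convexHull ℝ
  have hvol : (volume (convexHull ℝ (Set.range a))).toReal ≠ 0 :=
    ENNReal.toReal_ne_zero.2 ⟨(Measure.measure_pos_of_nonempty_interior volume
      (interior_convexHull_nonempty_iff_affineSpan_eq_top.2 hspan)).ne', hcomp.measure_lt_top.ne⟩
  have hintP (q : MvPolynomial (Fin 3) ℝ) :
      IntegrableOn (fun x ↦ eval x q) (convexHull ℝ (Set.range a)) :=
    q.continuous_eval.continuousOn.integrableOn_compact hcomp
  have hintB : IntegrableOn bT (convexHull ℝ (Set.range a)) :=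
    not_imp_comm.1 integral_undef hI.ne'
  have hmean (q : MvPolynomial (Fin 3) ℝ) (c : ℝ) :
      ∫ x in convexHull ℝ (Set.range a), (eval x q + c * bT x) =
        (∫ x in convexHull ℝ (Set.range a), eval x q) +
          c * ∫ x in convexHull ℝ (Set.range a), bT x := by
    rw [integral_add (hintP q) (hintB.const_mul c), integral_const_mul]
  have hba (i) : bT (a i) = 0 := by
    rw [hbT]
    fin_cases i <;> simp [hlam]
  have hmid (i j k : Fin 4) : b.coord k (midpoint ℝ (a i) (a j)) =
      ((if k = i then 1 else 0) + if k = j then 1 else 0) / 2 := by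
    rw [AffineMap.map_midpoint, hlam, hlam, midpoint_eq_smul_add, invOf_eq_inv, smul_eq_mul]
    ring
  have hbm (i j) : bT (midpoint ℝ (a i) (a j)) = 0 := by
    rw [hbT]
    simp only [hmid]
    fin_cases i <;> fin_cases j <;> simp
  simp only [hba, hbm, mul_zero, add_zero, hmean, div_eq_iff hvol]
  set p := quadInterp (fun i ↦ affinePoly (b.coord i)) (fun i ↦ C (d i)) fun i j ↦ C (dm i j)
  have hp (x) : eval x p = quadInterp (fun i ↦ b.coord i x) d dm := by
    simp only [p, eval_quadInterp, eval_affinePoly]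
  refine ⟨(p, (m * (volume (convexHull ℝ (Set.range a))).toReal -
    ∫ x in convexHull ℝ (Set.range a), eval x p) / ∫ x in convexHull ℝ (Set.range a), bT x),
    ⟨totalDegree_quadInterp_le (fun i ↦ totalDegree_affinePoly_le _) d dm, fun i ↦ ?_,
      fun i j hij ↦ ?_, ?_⟩, ?_⟩
  · rw [hp, quadInterp_expand]
    simp only [hlam]
    fin_cases i <;> simp <;> ring
  · rw [hp, quadInterp_expand]
    simp only [hmid]
    fin_cases i <;> fin_cases j <;> first | exact absurd hij (by decide) | (simp; ring)
  · rw [div_mul_cancel₀ _ hI.ne', add_sub_cancel]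
  · rintro ⟨q, c⟩ ⟨hdeg, hv, he, hmq⟩
    dsimp only at hdeg hv he hmq
    have hq : q = p := MvPolynomial.funext fun x ↦ by
      have hx : ∑ i, b.coord i x • a i = x := b.linear_combination_coord_eq_self x
      rw [hp, ← hx, eval_eq_quadInterp hdeg _ _ (b.sum_coord_apply_eq_one x), hx]
      simp only [quadInterp, hv]
      congr 1
      refine Finset.sum_congr rfl fun i _ ↦ Finset.sum_congr rfl fun j hj ↦ ?_
      rw [he i j (Finset.mem_Ioi.1 hj)]
    subst hq
    rw [Prod.mk.injEq, eq_div_iff hI.ne']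
    exact ⟨rfl, eq_sub_of_add_eq' hmq⟩
end
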